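/- Assume (A1), take α = 1, and suppose (max_{ℝ} f)·(max_{ℝ} g) < n − 1. Then for every ε > 0 quenching occurs in finite time: there exists T̃_ε < ∞ such that every positive classical solution u of the scaled problem on ℝ × [0,T) satisfies T ≤ T̃_ε; in particular no positive classical solution exists on ℝ × [0,∞). -/

import Mathlib

open Real Set Filter Topology

noncomputable section

/-- Partial derivative in the space variable `x`. -/
def pdx (u : ℝ → ℝ → ℝ) (x t : ℝ) : ℝ := deriv (fun y => u y t) x

/-- Second partial derivative in the space variable `x`. -/
def pdxx (u : ℝ → ℝ → ℝ) (x t : ℝ) : ℝ := deriv (fun y => pdx u y t) x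

/-- Partial derivative in the time variable `t`. -/
def pdt (u : ℝ → ℝ → ℝ) (x t : ℝ) : ℝ := deriv (fun s => u x s) t

/-- Assumption (A1): `f` is `C¹`, `ℤ`-periodic and positive; `g` is `C²`, `ℤ`-periodic
and positive. -/
def A1 (f g : ℝ → ℝ) : Prop :=
  ContDiff ℝ 1 f ∧ (∀ x, f (x + 1) = f x) ∧ (∀ x, 0 < f x) ∧
  ContDiff ℝ 2 g ∧ (∀ x, g (x + 1) = g x) ∧ (∀ x, 0 < g x)

/-- A positive classical solution of the scaled problem on `ℝ × [0, T)`, where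
`T : EReal` with `0 < T ≤ ∞`:
`u_t = u_xx/((u_x)² + 1) − (n−1)/u + (1/ε) f(x) √((u_x)² + 1)`, `u(x,0) = ε^α g(x)`. -/
structure IsSol (n : ℕ) (f g : ℝ → ℝ) (ε α : ℝ) (T : EReal) (u : ℝ → ℝ → ℝ) : Prop where
  pos : ∀ x t : ℝ, 0 ≤ t → (t : EReal) < T → 0 < u x t
  cont : ContinuousOn (fun p : ℝ × ℝ => u p.1 p.2)
    {p : ℝ × ℝ | 0 ≤ p.2 ∧ (p.2 : EReal) < T}
  smooth : ContDiffOn ℝ (⊤ : ℕ∞) (fun p : ℝ × ℝ => u p.1 p.2)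
    {p : ℝ × ℝ | 0 < p.2 ∧ (p.2 : EReal) < T}
  periodic : ∀ x t : ℝ, u (x + 1) t = u x t
  eqn : ∀ x t : ℝ, 0 < t → (t : EReal) < T →
    pdt u x t = pdxx u x t / ((pdx u x t) ^ 2 + 1) - ((n : ℝ) - 1) / u x t
      + (1 / ε) * f x * Real.sqrt ((pdx u x t) ^ 2 + 1)
  init : ∀ x : ℝ, u x 0 = ε ^ α * g x

/-- At a local maximum of a continuous function the second derivative is nonpositive. -/
theorem IsLocalMax.deriv_deriv_nonpos {h : ℝ → ℝ} {x : ℝ} (hx : IsLocalMax h x)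
    (hc : ContinuousAt h x) : deriv (deriv h) x ≤ 0 := by
  by_contra! hpos
  have hmin := isLocalMin_of_deriv_deriv_pos hpos hx.deriv_eq_zero hc
  have hconst : h =ᶠ[𝓝 x] fun _ => h x := by
    filter_upwards [hx, hmin] with y h1 h2 using le_antisymm h1 h2
  have h0 := hconst.deriv.deriv_eq
  simp at h0
  exact hpos.ne' h0

/-- If a function on `[0, t]` is maximal at the right endpoint, its derivative there is
nonnegative. -/
theorem HasDerivAt.nonneg_of_forall_le {h : ℝ → ℝ} {h' t : ℝ} (hd : HasDerivAt h h' t)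
    (ht : 0 < t) (hmax : ∀ s ∈ Icc 0 t, h s ≤ h t) : 0 ≤ h' := by
  have hs := (hasDerivAt_iff_tendsto_slope.1 hd).mono_left
    (nhdsWithin_mono t fun s (hs : s ∈ Iio t) => hs.ne)
  refine ge_of_tendsto hs ?_
  filter_upwards [Ioo_mem_nhdsLT ht] with s hs
  rw [slope_def_field]
  exact div_nonneg_of_nonpos (by linarith [hmax s ⟨hs.1.le, hs.2.le⟩]) (by linarith [hs.2])

namespace IsSol

variable {n : ℕ} {f g : ℝ → ℝ} {ε α : ℝ} {T : EReal} {u : ℝ → ℝ → ℝ}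

theorem contDiffAt (h : IsSol n f g ε α T u) {x t : ℝ} (ht : 0 < t) (htT : (t : EReal) < T) :
    ContDiffAt ℝ (⊤ : ℕ∞) (fun p : ℝ × ℝ => u p.1 p.2) (x, t) := by
  refine h.smooth.contDiffAt (IsOpen.mem_nhds ?_ ⟨ht, htT⟩)
  exact (isOpen_lt continuous_const continuous_snd).inter
    (isOpen_lt (continuous_coe_real_ereal.comp continuous_snd) continuous_const)

theorem differentiableAt_snd (h : IsSol n f g ε α T u) {x t : ℝ} (ht : 0 < t)
    (htT : (t : EReal) < T) : DifferentiableAt ℝ (fun s => u x s) t :=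
  ((h.contDiffAt (x := x) ht htT).differentiableAt (by simp)).comp t
    (f := fun s : ℝ => (x, s)) (by fun_prop)

theorem continuousAt_fst (h : IsSol n f g ε α T u) {x t : ℝ} (ht : 0 < t)
    (htT : (t : EReal) < T) : ContinuousAt (fun y => u y t) x :=
  (h.contDiffAt (x := x) ht htT).continuousAt.comp (f := fun y : ℝ => (y, t)) (by fun_prop)

/-- At a spatial maximum, the time derivative is controlled by the reaction terms. -/
theorem pdt_le_of_isMax (h : IsSol n f g ε α T u) {x t : ℝ} (ht : 0 < t)
    (htT : (t : EReal) < T) (hmax : ∀ y, u y t ≤ u x t) :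
    pdt u x t ≤ f x / ε - ((n : ℝ) - 1) / u x t := by
  have hloc : IsLocalMax (fun y => u y t) x := Eventually.of_forall hmax
  have hx : pdx u x t = 0 := hloc.deriv_eq_zero
  have hxx : pdxx u x t ≤ 0 := hloc.deriv_deriv_nonpos (h.continuousAt_fst ht htT)
  rw [h.eqn x t ht htT, hx]
  norm_num
  linarith [show ε⁻¹ * f x = f x / ε by ring]

/-- Comparison principle for the affine transforms `a(t) u + b(t)` of a solution. -/
theorem affine_nonpos (h : IsSol n f g ε α T u) {a b a' b' : ℝ → ℝ} {s : ℝ} (hs : 0 ≤ s)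
    (hsT : (s : EReal) < T) (ha : ∀ t, HasDerivAt a (a' t) t) (hb : ∀ t, HasDerivAt b (b' t) t)
    (hapos : ∀ t, 0 < a t) (h0 : ∀ x, a 0 * u x 0 + b 0 ≤ 0)
    (hstep : ∀ x t, 0 < t → t ≤ s → 0 < a t * u x t + b t →
      a' t * u x t + b' t + a t * (f x / ε - ((n : ℝ) - 1) / u x t) < 0) :
    ∀ x t, 0 ≤ t → t ≤ s → a t * u x t + b t ≤ 0 := by
  have hltT : ∀ t ≤ s, (t : EReal) < T := fun t ht =>
    (EReal.coe_le_coe_iff.2 ht).trans_lt hsT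
  have hcont : ContinuousOn (fun p : ℝ × ℝ => a p.2 * u p.1 p.2 + b p.2)
      (Icc (0 : ℝ) 1 ×ˢ Icc 0 s) := by
    have hac : Continuous a := continuous_iff_continuousAt.2 fun t => (ha t).continuousAt
    have hbc : Continuous b := continuous_iff_continuousAt.2 fun t => (hb t).continuousAt
    refine ((hac.comp continuous_snd).continuousOn.mul (h.cont.mono ?_)).add
      (hbc.comp continuous_snd).continuousOn
    exact fun p hp => ⟨hp.2.1, hltT _ hp.2.2⟩
  obtain ⟨⟨x₀, t₀⟩, ⟨-, ht₀⟩, hmax⟩ := (isCompact_Icc.prod isCompact_Icc).exists_isMaxOn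
    ⟨((0 : ℝ), (0 : ℝ)), ⟨by simp, by simpa using hs⟩⟩ hcont
  have hle : ∀ x, ∀ t ∈ Icc 0 s, a t * u x t + b t ≤ a t₀ * u x₀ t₀ + b t₀ := by
    intro x t ht
    have hper : Function.Periodic (fun y => u y t) 1 := fun y => h.periodic y t
    obtain ⟨y, hy, hxy⟩ := hper.exists_mem_Ico₀ one_pos x
    have := hmax (show (y, t) ∈ Icc (0 : ℝ) 1 ×ˢ Icc 0 s from ⟨⟨hy.1, hy.2.le⟩, ht⟩)
    rw [hxy]
    exact this
  suffices a t₀ * u x₀ t₀ + b t₀ ≤ 0 from fun x t ht hts => (hle x t ⟨ht, hts⟩).trans this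
  by_contra! hpos
  have ht₀' : 0 < t₀ := by
    refine ht₀.1.lt_of_ne ?_
    rintro rfl
    exact (h0 x₀).not_gt hpos
  have hder := ((ha t₀).mul (h.differentiableAt_snd (x := x₀) ht₀' (hltT _ ht₀.2)).hasDerivAt).add
    (hb t₀)
  have hnonneg := hder.nonneg_of_forall_le ht₀' fun t ht => hle x₀ t ⟨ht.1, ht.2.trans ht₀.2⟩
  have hpdt := h.pdt_le_of_isMax (x := x₀) ht₀' (hltT _ ht₀.2) fun y =>
    le_of_mul_le_mul_left (by linarith [hle y t₀ ht₀]) (hapos t₀)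
  have := mul_le_mul_of_nonneg_left hpdt (hapos t₀).le
  have := hstep x₀ t₀ ht₀' ht₀.2 hpos
  change 0 ≤ a' t₀ * u x₀ t₀ + a t₀ * pdt u x₀ t₀ + b' t₀ at hnonneg
  linarith

/-- If the reaction terms are bounded by `-δ` at the level `B` of the initial data, then the
solution stays below `B`. -/
theorem le_of_init_le (h : IsSol n f g ε α T u) (hn : 1 ≤ n) {B δ s : ℝ} (hs : 0 ≤ s)
    (hsT : (s : EReal) < T) (hB : 0 < B) (hδ : 0 < δ) (h0 : ∀ x, u x 0 ≤ B)
    (hf : ∀ x, f x / ε - ((n : ℝ) - 1) / B ≤ -δ) :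
    ∀ x t, 0 ≤ t → t ≤ s → u x t ≤ B := by
  have hn' : (0 : ℝ) ≤ (n : ℝ) - 1 := by
    have : (1 : ℝ) ≤ n := by exact_mod_cast hn
    linarith
  set A : ℝ := ((n : ℝ) - 1) / B ^ 2 with hA
  have hexp : ∀ t, HasDerivAt (fun t : ℝ => exp (-A * t)) (-A * exp (-A * t)) t := fun t => by
    have := ((hasDerivAt_id t).const_mul (-A)).exp
    simpa [mul_comm] using this
  have key := h.affine_nonpos (a := fun t => exp (-A * t)) (b := fun t => exp (-A * t) * -B)
    hs hsT hexp (fun t => (hexp t).mul_const (-B)) (fun t => exp_pos _)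
    (fun x => by simpa using h0 x) ?_
  · intro x t ht hts
    have hx := key x t ht hts
    refine le_of_mul_le_mul_left ?_ (exp_pos (-A * t))
    linarith
  · intro x t ht hts hpos
    have hE := exp_pos (-A * t)
    have huB : B < u x t := lt_of_mul_lt_mul_left (by linarith) hE.le
    have hu := hB.trans huB
    have hrec : ((n : ℝ) - 1) / B - ((n : ℝ) - 1) / u x t ≤ A * (u x t - B) := by
      have heq : ((n : ℝ) - 1) / B - ((n : ℝ) - 1) / u x t
          = ((n : ℝ) - 1) / (B * u x t) * (u x t - B) := by field_simp
      rw [heq, hA]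
      refine mul_le_mul_of_nonneg_right ?_ (by linarith)
      exact div_le_div_of_nonneg_left hn' (by positivity) (by nlinarith)
    have hneg : -A * (u x t - B) + (f x / ε - ((n : ℝ) - 1) / u x t) < 0 := by
      linarith [hf x]
    have := mul_neg_of_pos_of_neg hE hneg
    linarith

/-- Under the same hypotheses the solution decays at least linearly. -/
theorem le_sub_mul_of_init_le (h : IsSol n f g ε α T u) (hn : 1 ≤ n) {B δ s : ℝ} (hs : 0 ≤ s)
    (hsT : (s : EReal) < T) (hB : 0 < B) (hδ : 0 < δ) (h0 : ∀ x, u x 0 ≤ B)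
    (hf : ∀ x, f x / ε - ((n : ℝ) - 1) / B ≤ -δ) :
    ∀ x t, 0 ≤ t → t ≤ s → u x t ≤ B - δ / 2 * t := by
  have hn' : (0 : ℝ) ≤ (n : ℝ) - 1 := by
    have : (1 : ℝ) ≤ n := by exact_mod_cast hn
    linarith
  have hle := h.le_of_init_le hn hs hsT hB hδ h0 hf
  have key := h.affine_nonpos (a := fun _ => 1) (b := fun t => t * (δ / 2) - B)
    (a' := fun _ => 0) (b' := fun _ => 1 * (δ / 2)) hs hsT (fun t => hasDerivAt_const t 1)
    (fun t => ((hasDerivAt_id t).mul_const (δ / 2)).sub_const B) (fun _ => one_pos)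
    (fun x => by simpa using h0 x) ?_
  · intro x t ht hts
    linarith [key x t ht hts]
  · intro x t ht hts _
    have hu := h.pos x t ht.le ((EReal.coe_le_coe_iff.2 hts).trans_lt hsT)
    have := div_le_div_of_nonneg_left hn' hu (hle x t ht.le hts)
    linarith [hf x]

end IsSol

/-- Under (A1), for `α = 1`, if `(max f)·(max g) < n − 1` then for every
`ε > 0` quenching occurs in finite time: there is a finite `T̃_ε` such that every positive
classical solution of the scaled problem on `ℝ × [0,T)` satisfies `T ≤ T̃_ε`
(in particular there is no positive classical solution on `ℝ × [0,∞)`). -/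
theorem quenching_critical (n : ℕ) (hn : 2 ≤ n) (f g : ℝ → ℝ) (hA1 : A1 f g)
    (hfg : sSup (Set.range f) * sSup (Set.range g) < (n : ℝ) - 1) :
    ∀ ε : ℝ, 0 < ε →
      ∃ Tmax : ℝ, ∀ T : EReal, 0 < T → ∀ u : ℝ → ℝ → ℝ,
        IsSol n f g ε 1 T u → T ≤ (Tmax : EReal) := by
  intro ε hε
  obtain ⟨hfC, hfp, hfpos, hgC, hgp, hgpos⟩ := hA1
  have hfle : ∀ x, f x ≤ sSup (range f) := fun x => le_csSup
    (Function.Periodic.isBounded_of_continuous hfp one_ne_zero hfC.continuous).bddAbove ⟨x, rfl⟩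
  have hgle : ∀ x, g x ≤ sSup (range g) := fun x => le_csSup
    (Function.Periodic.isBounded_of_continuous hgp one_ne_zero hgC.continuous).bddAbove ⟨x, rfl⟩
  set F := sSup (range f)
  set G := sSup (range g)
  have hG : 0 < G := (hgpos 0).trans_le (hgle 0)
  have hB : 0 < ε * G := mul_pos hε hG
  obtain ⟨δ, hδdef⟩ : ∃ δ, δ = ((n : ℝ) - 1) / (ε * G) - F / ε := ⟨_, rfl⟩
  have hδ : 0 < δ := by
    have heq : δ = ((n : ℝ) - 1 - F * G) / (ε * G) := by
      rw [hδdef]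
      field_simp
    rw [heq]
    exact div_pos (by linarith) hB
  refine ⟨ε * G / (δ / 2), fun T _ u hu => ?_⟩
  by_contra! hT
  have hs : 0 ≤ ε * G / (δ / 2) := by positivity
  have hle := hu.le_sub_mul_of_init_le (by lia) hs hT hB hδ
    (fun x => by
      rw [hu.init x, Real.rpow_one]
      exact mul_le_mul_of_nonneg_left (hgle x) hε.le)
    (fun x => by
      have := div_le_div_of_nonneg_right (hfle x) hε.le
      linarith) 0 _ hs le_rfl
  rw [mul_div_cancel₀ _ (by positivity : δ / 2 ≠ 0), sub_self] at hle
  exact hle.not_gt (hu.pos 0 _ hs hT)
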